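/- Let r ≥ 4 and suppose a projective plane of order r−1 exists, and let T_r be the associated truncated projective plane with sides V_1,…,V_r. Then for every edge S of T_r: (i) S intersects every other edge of T_r in exactly one vertex; (ii) τ(T_r − S) = r−1; and (iii) the only covers of T_r − S of cardinality r−1 are the sides V_1,…,V_r. -/

import Mathlib

open Finset

noncomputable section
open scoped Classical

/-- A set of vertices `C` covers the hypergraph `H` if it meets every edge. -/
def IsCover {V : Type*} (C : Set V) (H : Set (Finset V)) : Prop :=
  ∀ e ∈ H, ∃ v ∈ C, v ∈ e

/-- The cover number `τ(H)`: the minimum cardinality of a cover of `H`. -/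
noncomputable def coverNumber {V : Type*} (H : Set (Finset V)) : ℕ :=
  sInf {n | ∃ C : Finset V, IsCover (↑C) H ∧ C.card = n}

/-- The matching number `ν(H)`: the maximum size of a set of pairwise disjoint edges. -/
noncomputable def matchingNumber {V : Type*} (H : Set (Finset V)) : ℕ :=
  sSup {n | ∃ M : Finset (Finset V), ↑M ⊆ H ∧
    (M : Set (Finset V)).Pairwise (fun e₁ e₂ => Disjoint e₁ e₂) ∧ M.card = n}

/-- A hypergraph is intersecting if any two edges share a vertex. -/
def Intersecting {V : Type*} (H : Set (Finset V)) : Prop :=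
  ∀ e₁ ∈ H, ∀ e₂ ∈ H, ∃ v, v ∈ e₁ ∧ v ∈ e₂

/-- A hypergraph is `r`-uniform if every edge has exactly `r` vertices. -/
def Uniform {V : Type*} (H : Set (Finset V)) (r : ℕ) : Prop :=
  ∀ e ∈ H, e.card = r

/-- `H` is `r`-partite with the given sides: the sides partition the vertex set and
every edge has at most one vertex in each side. -/
def Partite {V : Type*} {r : ℕ} (H : Set (Finset V)) (sides : Fin r → Set V) : Prop :=
  (∀ v : V, ∃! i, v ∈ sides i) ∧
  ∀ e ∈ H, ∀ i : Fin r, ∀ x ∈ e, ∀ y ∈ e, x ∈ sides i → y ∈ sides i → x = y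

/-- Two hypergraphs are isomorphic if a bijection of the vertex sets carries the
edge set of one onto the edge set of the other. -/
def Isomorphic {V W : Type*} (H₁ : Set (Finset V)) (H₂ : Set (Finset W)) : Prop :=
  ∃ φ : V ≃ W, ∀ e : Finset V, e ∈ H₁ ↔ e.image φ ∈ H₂

/-- The edge `Ê = E ∪ {v_i}`, where the new vertex `v_i` is encoded as `Sum.inr i`. -/
def hatE {V : Type*} {r : ℕ} (E : Finset V) (i : Fin r) : Finset (V ⊕ Fin r) :=
  insert (Sum.inr i) (E.image Sum.inl)

/-- The construction `H(T, S, F_1, …, F_r)`, with new vertices `v_i = Sum.inr i`. -/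
def constructionH {V : Type*} {r : ℕ} (T : Set (Finset V)) (S : Finset V)
    (s : Fin r → V) (F : Fin r → Finset V) : Set (Finset (V ⊕ Fin r)) :=
  {Eh | ∃ E ∈ T, E ≠ S ∧ ∃ i : Fin r, s i ∈ E ∧ Eh = hatE E i} ∪
  {Eh | ∃ i : Fin r, Eh = (F i).image Sum.inl} ∪
  {Eh | ∃ i : Fin r, Eh = hatE ((F i).erase (s i)) i}

/-- The hypergraph `S(T, S, F_1, …, F_r) = E2 ∪ E3`. -/
def constructionS {V : Type*} {r : ℕ}
    (s : Fin r → V) (F : Fin r → Finset V) : Set (Finset (V ⊕ Fin r)) :=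
  {Eh | ∃ i : Fin r, Eh = (F i).image Sum.inl} ∪
  {Eh | ∃ i : Fin r, Eh = hatE ((F i).erase (s i)) i}

/-- The sides of the construction: the old sides (lifted), plus the new side `{v_1, …, v_r}`. -/
def extSides {V : Type*} {r : ℕ} (sides : Fin r → Set V) : Fin (r + 1) → Set (V ⊕ Fin r) :=
  Fin.lastCases (Set.range Sum.inr) (fun i => Sum.inl '' sides i)

open Configuration

/-- The points of the line `ℓ` other than `w`, as a finset of the vertex type `{p // p ≠ w}`. -/
noncomputable def linePoints {P L : Type*} [Membership P L] [Fintype P] (w : P) (ℓ : L) :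
    Finset {p : P // p ≠ w} :=
  Finset.univ.filter (fun p : {p : P // p ≠ w} => (p : P) ∈ ℓ)

/-- The truncated projective plane at the point `w`: the edges are the point sets of
the lines not passing through `w`, on the vertex set of points other than `w`. -/
noncomputable def truncatedPP (P : Type*) (L : Type*) [Membership P L] [Fintype P] (w : P) :
    Set (Finset {p : P // p ≠ w}) :=
  {E | ∃ ℓ : L, w ∉ ℓ ∧ E = linePoints w ℓ}

/-- The sides of the truncated projective plane, given an enumeration `m` of
the lines through `w`. -/
def ppSide {P L : Type*} [Membership P L] {r : ℕ} (w : P) (m : Fin r → L) (i : Fin r) :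
    Set {p : P // p ≠ w} :=
  {p : {p : P // p ≠ w} | (p : P) ∈ m i}

/-- `m` enumerates the lines through `w`. -/
def EnumeratesLinesThrough {P L : Type*} [Membership P L] {r : ℕ} (w : P) (m : Fin r → L) : Prop :=
  Function.Injective m ∧ (∀ i, w ∈ m i) ∧ ∀ ℓ : L, w ∈ ℓ → ∃ i, m i = ℓ

/-- The lines through `p` that avoid `w`. -/
def linesThroughAvoiding {P : Type*} (L : Type*) [Membership P L] [Fintype L] (w p : P) :
    Finset L :=
  Finset.univ.filter (fun ℓ : L => w ∉ ℓ ∧ p ∈ ℓ)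

/-- Distinct lines meet in a unique point other than `w`, if one of them avoids `w`. -/
theorem existsUnique_mem_linePoints {P L : Type*} [Membership P L] [Fintype P]
    [ProjectivePlane P L] {w : P} {ℓ ℓ' : L} (hw : w ∉ ℓ) (hne : ℓ ≠ ℓ') :
    ∃! x, x ∈ linePoints w ℓ ∧ x ∈ linePoints w ℓ' := by
  obtain ⟨p, hp, hu⟩ := HasPoints.existsUnique_point P L ℓ ℓ' hne
  refine ⟨⟨p, fun e => hw (e ▸ hp.1)⟩, by simpa [linePoints] using hp, fun y hy => ?_⟩
  simp only [linePoints, Finset.mem_filter, Finset.mem_univ, true_and] at hy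
  exact Subtype.ext (hu y hy)

/-- The points other than `w` on a line through `w` cover the truncated plane. -/
theorem isCover_linePoints {P L : Type*} [Membership P L] [Fintype P]
    [ProjectivePlane P L] {w : P} {n : L} (hw : w ∈ n) :
    IsCover (↑(linePoints w n)) (truncatedPP P L w) := by
  rintro e ⟨ℓ, hℓ, rfl⟩
  obtain ⟨x, ⟨hx, hx'⟩, -⟩ :=
    existsUnique_mem_linePoints hℓ (fun e : ℓ = n => hℓ (e ▸ hw))
  exact ⟨x, hx', hx⟩

section ProjectivePlane

variable {P L : Type*} [Membership P L] [Fintype P] [Fintype L] [ProjectivePlane P L]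

theorem card_filter_mem_line (p : P) :
    (Finset.univ.filter (fun ℓ : L => p ∈ ℓ)).card = ProjectivePlane.order P L + 1 := by
  rw [← ProjectivePlane.lineCount_eq (L := L) p, lineCount, Nat.card_eq_fintype_card,
    Fintype.card_subtype]

theorem card_filter_mem_point (ℓ : L) :
    (Finset.univ.filter (fun p : P => p ∈ ℓ)).card = ProjectivePlane.order P L + 1 := by
  rw [← ProjectivePlane.pointCount_eq (P := P) ℓ, pointCount, Nat.card_eq_fintype_card,
    Fintype.card_subtype]

theorem card_lines_avoiding (w : P) :
    (Finset.univ.filter (fun ℓ : L => w ∉ ℓ)).card = ProjectivePlane.order P L ^ 2 := by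
  have h := Finset.card_filter_add_card_filter_not (s := (Finset.univ : Finset L))
    (fun ℓ => w ∈ ℓ)
  rw [card_filter_mem_line, Finset.card_univ, ProjectivePlane.card_lines P L] at h
  omega

theorem card_linesThroughAvoiding {w p : P} (hp : p ≠ w) :
    (linesThroughAvoiding L w p).card = ProjectivePlane.order P L := by
  obtain ⟨n, ⟨hpn, hwn⟩, hn⟩ := HasLines.existsUnique_line P L p w hp
  have h : linesThroughAvoiding L w p = (Finset.univ.filter (fun ℓ : L => p ∈ ℓ)).erase n := by
    ext ℓ
    simp only [linesThroughAvoiding, Finset.mem_filter, Finset.mem_univ, true_and,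
      Finset.mem_erase]
    exact ⟨fun h => ⟨fun e => h.1 (e ▸ hwn), h.2⟩, fun h => ⟨fun hw => h.1 (hn ℓ ⟨h.2, hw⟩), h.2⟩⟩
  rw [h, Finset.card_erase_of_mem (by simpa using hpn), card_filter_mem_line]
  rfl

theorem card_linePoints_of_mem {w : P} {ℓ : L} (hw : w ∈ ℓ) :
    (linePoints w ℓ).card = ProjectivePlane.order P L := by
  have h : (linePoints w ℓ).map (Function.Embedding.subtype _) =
      (Finset.univ.filter (fun p : P => p ∈ ℓ)).erase w := by
    ext p
    simp [linePoints, and_comm]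
  rw [← Finset.card_map (Function.Embedding.subtype _), h,
    Finset.card_erase_of_mem (by simpa using hw), card_filter_mem_point]
  rfl

theorem card_linePoints_of_notMem {w : P} {ℓ : L} (hw : w ∉ ℓ) :
    (linePoints w ℓ).card = ProjectivePlane.order P L + 1 := by
  have h : (linePoints w ℓ).map (Function.Embedding.subtype _) =
      Finset.univ.filter (fun p : P => p ∈ ℓ) := by
    ext p
    simp only [linePoints, Finset.mem_map, Finset.mem_filter, Finset.mem_univ, true_and,
      Function.Embedding.coe_subtype, Subtype.exists, exists_and_left, exists_prop]
    exact ⟨fun ⟨_, h, _, e⟩ => e ▸ h, fun h => ⟨p, h, fun e => hw (e ▸ h), rfl⟩⟩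
  rw [← Finset.card_map (Function.Embedding.subtype _), h, card_filter_mem_point]

/-- Two lines avoiding `w` are equal as soon as their point sets are. -/
theorem eq_of_linePoints_eq {w : P} {ℓ ℓ' : L} (hw : w ∉ ℓ)
    (h : linePoints w ℓ = linePoints w ℓ') : ℓ = ℓ' := by
  have hcard : 1 < (linePoints w ℓ).card := by
    rw [card_linePoints_of_notMem hw]
    have := ProjectivePlane.one_lt_order P L
    omega
  obtain ⟨x, hx, y, hy, hxy⟩ := Finset.one_lt_card.1 hcard
  have hx' := h ▸ hx
  have hy' := h ▸ hy
  simp only [linePoints, Finset.mem_filter, Finset.mem_univ, true_and] at hx hy hx' hy'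
  exact (Nondegenerate.eq_or_eq hx hy hx' hy').resolve_left fun e => hxy (Subtype.ext e)

/-- The lines met by a cover of the truncated plane minus an edge number at least `q ^ 2 - 1`. -/
theorem order_sq_le_card_biUnion {w : P} {S : Finset {p : P // p ≠ w}}
    (hS : S ∈ truncatedPP P L w) {C : Finset {p : P // p ≠ w}}
    (hC : IsCover (↑C) (truncatedPP P L w \ {S})) :
    ProjectivePlane.order P L ^ 2 ≤
      (C.biUnion fun p => linesThroughAvoiding L w (p : P)).card + 1 := by
  obtain ⟨s, hs, rfl⟩ := hS
  have hsub : (Finset.univ.filter (fun ℓ : L => w ∉ ℓ)) ⊆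
      insert s (C.biUnion fun p => linesThroughAvoiding L w (p : P)) := by
    intro ℓ hℓ
    have hℓ : w ∉ ℓ := by simpa using hℓ
    rw [Finset.mem_insert, or_iff_not_imp_left]
    intro hne
    obtain ⟨v, hv, hvℓ⟩ := hC (linePoints w ℓ)
      ⟨⟨ℓ, hℓ, rfl⟩, fun h => hne (eq_of_linePoints_eq hℓ h)⟩
    refine Finset.mem_biUnion.2 ⟨v, hv, ?_⟩
    simpa [linesThroughAvoiding, hℓ, linePoints] using hvℓ
  rw [← card_lines_avoiding w]
  exact (Finset.card_le_card hsub).trans (Finset.card_insert_le _ _)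

theorem card_biUnion_linesThroughAvoiding_le {w : P} (C : Finset {p : P // p ≠ w}) :
    (C.biUnion fun p => linesThroughAvoiding L w (p : P)).card ≤
      C.card * ProjectivePlane.order P L :=
  Finset.card_biUnion_le_card_mul _ _ _ fun p _ => (card_linesThroughAvoiding p.2).le

theorem order_le_card_of_isCover {w : P} {S : Finset {p : P // p ≠ w}}
    (hS : S ∈ truncatedPP P L w) {C : Finset {p : P // p ≠ w}}
    (hC : IsCover (↑C) (truncatedPP P L w \ {S})) :
    ProjectivePlane.order P L ≤ C.card := by
  have h₁ := order_sq_le_card_biUnion hS hC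
  have h₂ := card_biUnion_linesThroughAvoiding_le (L := L) C
  have h₃ := ProjectivePlane.one_lt_order P L
  by_contra! h
  nlinarith

/-- If the line joining `x` and `y` avoids `w`, then adjoining the lines through `y` to a set
containing the lines through `x` adds fewer than `q` lines. -/
theorem card_union_linesThroughAvoiding_lt {w x y : P} (hy : y ≠ w)
    (hxy : ∀ ℓ : L, x ∈ ℓ → y ∈ ℓ → w ∉ ℓ) (hne : x ≠ y) {B : Finset L}
    (hB : linesThroughAvoiding L w x ⊆ B) :
    (linesThroughAvoiding L w y ∪ B).card < ProjectivePlane.order P L + B.card := by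
  obtain ⟨n, ⟨hx, hyn⟩, -⟩ := HasLines.existsUnique_line P L x y hne
  have hw := hxy n hx hyn
  have hpos : 0 < (linesThroughAvoiding L w y ∩ B).card :=
    Finset.card_pos.2 ⟨n, Finset.mem_inter.2
      ⟨by simp [linesThroughAvoiding, hw, hyn], hB (by simp [linesThroughAvoiding, hw, hx])⟩⟩
  have h := Finset.card_union_add_card_inter (linesThroughAvoiding L w y) B
  rw [card_linesThroughAvoiding hy] at h
  omega

/-- Any two points of a minimum cover of the truncated plane minus an edge are collinear
with `w`. -/
theorem exists_line_of_mem_isCover (hq : 3 ≤ ProjectivePlane.order P L) {w : P}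
    {S : Finset {p : P // p ≠ w}} (hS : S ∈ truncatedPP P L w) {C : Finset {p : P // p ≠ w}}
    (hC : IsCover (↑C) (truncatedPP P L w \ {S})) (hcard : C.card = ProjectivePlane.order P L)
    {x y : {p : P // p ≠ w}} (hx : x ∈ C) (hy : y ∈ C) :
    ∃ ℓ : L, (x : P) ∈ ℓ ∧ (y : P) ∈ ℓ ∧ w ∈ ℓ := by
  by_contra! hxy
  have hne : x ≠ y := by
    rintro rfl
    obtain ⟨n, ⟨h₁, h₂⟩, -⟩ := HasLines.existsUnique_line P L (x : P) w x.2
    exact hxy n h₁ h₁ h₂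
  have hyC : y ∈ C.erase x := Finset.mem_erase.2 ⟨hne.symm, hy⟩
  have hcard₂ : ((C.erase x).erase y).card = ProjectivePlane.order P L - 2 := by
    rw [Finset.card_erase_of_mem hyC, Finset.card_erase_of_mem hx, hcard]
    rfl
  obtain ⟨z, hz⟩ : ((C.erase x).erase y).Nonempty := Finset.card_pos.1 (by omega)
  have hzy : z ≠ y := (Finset.mem_erase.1 hz).1
  have hzx : z ≠ x := (Finset.mem_erase.1 (Finset.mem_erase.1 hz).2).1
  have hcard₃ : (((C.erase x).erase y).erase z).card = ProjectivePlane.order P L - 3 := by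
    rw [Finset.card_erase_of_mem hz, hcard₂]
    rfl
  set D := ((C.erase x).erase y).erase z
  set A : {p : P // p ≠ w} → Finset L := fun p => linesThroughAvoiding L w (p : P)
  have hCD : C.biUnion A = (A z ∪ (A y ∪ A x)) ∪ D.biUnion A := by
    rw [← Finset.insert_erase hx, ← Finset.insert_erase hyC, ← Finset.insert_erase hz,
      Finset.biUnion_insert, Finset.biUnion_insert, Finset.biUnion_insert]
    ext ℓ
    simp only [Finset.mem_union]
    tauto
  have h₁ := order_sq_le_card_biUnion hS hC
  change _ ≤ (C.biUnion A).card + 1 at h₁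
  have h₂ : (D.biUnion A).card ≤ _ := card_biUnion_linesThroughAvoiding_le (L := L) D
  have h₃ : (A y ∪ A x).card < _ := card_union_linesThroughAvoiding_lt y.2 hxy
    (fun e => hne (Subtype.ext e)) (Finset.Subset.refl _)
  have h₄ : (A z ∪ (A y ∪ A x)).card < ProjectivePlane.order P L + (A y ∪ A x).card := by
    by_cases h : ∃ ℓ : L, (x : P) ∈ ℓ ∧ (z : P) ∈ ℓ ∧ w ∈ ℓ
    · obtain ⟨ℓ, hxℓ, hzℓ, hwℓ⟩ := h
      refine card_union_linesThroughAvoiding_lt (x := (y : P)) z.2 (fun k hyk hzk hwk => ?_)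
        (fun e => hzy (Subtype.ext e.symm)) Finset.subset_union_left
      obtain rfl : ℓ = k := (Nondegenerate.eq_or_eq hzℓ hwℓ hzk hwk).resolve_left z.2
      exact hxy ℓ hxℓ hyk hwℓ
    · push Not at h
      exact card_union_linesThroughAvoiding_lt (x := (x : P)) z.2 h
        (fun e => hzx (Subtype.ext e.symm)) Finset.subset_union_right
  have h₅ : (A x).card = ProjectivePlane.order P L := card_linesThroughAvoiding x.2
  have h₆ := Finset.card_union_le (A z ∪ (A y ∪ A x)) (D.biUnion A)
  rw [hcard₃] at h₂
  rw [← hCD] at h₆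
  obtain ⟨k, hk⟩ := Nat.exists_eq_add_of_le hq
  rw [h₅] at h₃
  rw [hk] at h₁ h₂ h₃ h₄
  rw [Nat.add_sub_cancel_left] at h₂
  nlinarith

end ProjectivePlane

theorem statement_11 {P L : Type*} [Membership P L] [Fintype P] [Fintype L]
    [Configuration.ProjectivePlane P L] {r : ℕ} (hr : 4 ≤ r)
    (horder : Configuration.ProjectivePlane.order P L = r - 1) (w : P)
    (m : Fin r → L) (hm : EnumeratesLinesThrough w m)
    (S : Finset {p : P // p ≠ w}) (hS : S ∈ truncatedPP P L w) :
    (∀ E ∈ truncatedPP P L w, E ≠ S → ∃! x, x ∈ E ∧ x ∈ S) ∧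
    coverNumber (truncatedPP P L w \ {S}) = r - 1 ∧
    ∀ C : Finset {p : P // p ≠ w}, IsCover (↑C) (truncatedPP P L w \ {S}) →
      C.card = r - 1 → ∃ i, (C : Set {p : P // p ≠ w}) = ppSide w m i := by
  have hq : 3 ≤ ProjectivePlane.order P L := by omega
  have hside (i : Fin r) : (linePoints w (m i) : Set {p : P // p ≠ w}) = ppSide w m i := by
    ext p
    simp [linePoints, ppSide]
  refine ⟨?_, ?_, ?_⟩
  · rintro E ⟨ℓ, hℓ, rfl⟩ hne
    obtain ⟨s, hs, rfl⟩ := hS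
    exact existsUnique_mem_linePoints hℓ (fun e => hne (e ▸ rfl))
  · rw [← horder]
    let i : Fin r := ⟨0, by omega⟩
    have hmem : ProjectivePlane.order P L ∈ {n | ∃ C : Finset {p : P // p ≠ w},
        IsCover (↑C) (truncatedPP P L w \ {S}) ∧ C.card = n} :=
      ⟨linePoints w (m i), fun e he => isCover_linePoints (hm.2.1 i) e he.1,
        card_linePoints_of_mem (hm.2.1 i)⟩
    refine le_antisymm (Nat.sInf_le hmem) (le_csInf ⟨_, hmem⟩ ?_)
    rintro n ⟨C, hC, rfl⟩
    exact order_le_card_of_isCover hS hC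
  · intro C hC hcard
    rw [← horder] at hcard
    obtain ⟨x, hx⟩ : C.Nonempty := Finset.card_pos.1 (by omega)
    obtain ⟨n, ⟨hxn, hwn⟩, -⟩ := HasLines.existsUnique_line P L (x : P) w x.2
    obtain ⟨i, rfl⟩ := hm.2.2 n hwn
    refine ⟨i, ?_⟩
    rw [← hside, Finset.coe_inj]
    refine Finset.eq_of_subset_of_card_le (fun y hy => ?_)
      (by rw [card_linePoints_of_mem hwn, hcard])
    obtain ⟨ℓ, hxℓ, hyℓ, hwℓ⟩ := exists_line_of_mem_isCover (L := L) hq hS hC hcard hx hy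
    obtain rfl : ℓ = m i := (Nondegenerate.eq_or_eq hxℓ hwℓ hxn hwn).resolve_left x.2
    simpa [linePoints] using hyℓ

end
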